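/- Let μ′₃ be the product on ℂ³ given by μ′₃(e₁,e₂) = e₁, μ′₃(e₂,e₃) = e₁ − e₃, μ′₃(e₃,e₁) = 0. Then a linear map T = (T_{ij}) belongs to HL(μ′₃) if and only if T₂₁ = 0 and T₂₃ = 0. Moreover, every T ∈ HL(μ′₃) is equivalent under the G_{μ′₃}-action T ↦ g∘T∘g⁻¹ to one of the following canonical forms: (1) if T₃₁ = 0, to [[p,b,c],[0,q,0],[0,s,r]]; (2) if T₃₁ ≠ 0, to [[p,b,c],[0,q,0],[w,0,0]] with w ≠ 0. -/

import Mathlib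

noncomputable section
open Matrix

abbrev V3 : Type := Fin 3 → ℂ
abbrev Mat3 : Type := Matrix (Fin 3) (Fin 3) ℂ

/-- The cross product on `ℂ³`. -/
def cross3 (x y : V3) : V3 :=
  ![x 1 * y 2 - x 2 * y 1, x 2 * y 0 - x 0 * y 2, x 0 * y 1 - x 1 * y 0]

/-- The skew-symmetric bilinear product on `ℂ³` encoded by the matrix `M`:
`μ(e₂,e₃) = col₀ M`, `μ(e₃,e₁) = col₁ M`, `μ(e₁,e₂) = col₂ M`. -/
def prodOf (M : Mat3) : V3 → V3 → V3 := fun x y => M.mulVec (cross3 x y)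

/-- `T` satisfies the Hom-Lie Jacobi identity for the product `μ`. -/
def HL (μ : V3 → V3 → V3) (T : Mat3) : Prop :=
  ∀ x y z : V3,
    μ (T.mulVec x) (μ y z) + μ (T.mulVec y) (μ z x) + μ (T.mulVec z) (μ x y) = 0

/-- `g` is an invertible automorphism of the product `μ`. -/
def IsAut (μ : V3 → V3 → V3) (g : Mat3) : Prop :=
  g.det ≠ 0 ∧ ∀ x y : V3, g.mulVec (μ x y) = μ (g.mulVec x) (g.mulVec y)

/-- Equivalence of elements of `HL(μ)` under the action `T ↦ g ∘ T ∘ g⁻¹` of `G_μ`. -/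
def HLequiv (μ : V3 → V3 → V3) (T T' : Mat3) : Prop :=
  ∃ g : Mat3, IsAut μ g ∧ T' = g * T * g⁻¹

/-- Equivalence of matrices under the `GL₃(ℂ)`-action `M ↦ (det g)⁻¹ • g * M * gᵀ`. -/
def MEquiv (A B : Mat3) : Prop :=
  ∃ g : Mat3, g.det ≠ 0 ∧ B = (g.det)⁻¹ • (g * A * gᵀ)

/-- Equivalence of products under the `GL₃(ℂ)`-action `(g·μ)(x,y) = g(μ(g⁻¹x, g⁻¹y))`. -/
def ProdEquiv (μ ν : V3 → V3 → V3) : Prop :=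
  ∃ g : Mat3, g.det ≠ 0 ∧ ∀ x y : V3, ν x y = g.mulVec (μ (g⁻¹.mulVec x) (g⁻¹.mulVec y))

/-- The matrix of the product `μ′₃`:
`μ′₃(e₁,e₂) = e₁`, `μ′₃(e₂,e₃) = e₁ - e₃`, `μ′₃(e₃,e₁) = 0`. -/
def Md13 : Mat3 := !![1, 0, 1; 0, 0, 0; -1, 0, 0]

lemma HL_Md13_iff (T : Mat3) : HL (prodOf Md13) T ↔ T 1 0 = 0 ∧ T 1 2 = 0 := by
  constructor
  · intro h
    have h := h ![1, 0, 0] ![0, 1, 0] ![0, 0, 1]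
    have h₀ := congrFun h 0
    have h₂ := congrFun h 2
    simp [prodOf, cross3, Md13, Matrix.mulVec, dotProduct, Fin.sum_univ_three] at h₀ h₂
    grind
  · rintro ⟨h₁, h₂⟩ x y z
    ext i
    fin_cases i <;>
      simp [prodOf, cross3, Md13, Matrix.mulVec, dotProduct, Fin.sum_univ_three, h₁, h₂] <;> ring

/-- The automorphisms of `μ′₃` fixing `e₁` and moving `e₂`, `e₃` by multiples of `e₁`. -/
def shear (u n : ℂ) : Mat3 := !![1, u, n; 0, 1, 0; 0, 0, 1]

lemma det_shear (u n : ℂ) : (shear u n).det = 1 := by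
  simp [shear, Matrix.det_fin_three]

lemma isAut_shear (u n : ℂ) : IsAut (prodOf Md13) (shear u n) := by
  refine ⟨by simp [det_shear], fun x y => ?_⟩
  ext i
  fin_cases i <;>
    simp [shear, prodOf, cross3, Md13, Matrix.mulVec, dotProduct, Fin.sum_univ_three]
  ring

lemma shear_inv (u n : ℂ) : (shear u n)⁻¹ = shear (-u) (-n) := by
  apply Matrix.inv_eq_right_inv
  ext i j
  fin_cases i <;> fin_cases j <;> simp [shear, Matrix.mul_apply, Fin.sum_univ_three]

lemma HLequiv_refl (μ : V3 → V3 → V3) (T : Mat3) : HLequiv μ T T :=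
  ⟨1, ⟨by simp, by simp⟩, by simp⟩

theorem stmt19 :
    (∀ T : Mat3, HL (prodOf Md13) T ↔ (T 1 0 = 0 ∧ T 1 2 = 0)) ∧
    (∀ T : Mat3, HL (prodOf Md13) T →
      ((T 2 0 = 0 →
        ∃ p b c q s r : ℂ, HLequiv (prodOf Md13) T !![p, b, c; 0, q, 0; 0, s, r]) ∧
       (T 2 0 ≠ 0 →
        ∃ p b c q w : ℂ, w ≠ 0 ∧
          HLequiv (prodOf Md13) T !![p, b, c; 0, q, 0; w, 0, 0]))) := by
  refine ⟨HL_Md13_iff, fun T hT => ?_⟩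
  obtain ⟨h₁, h₂⟩ := (HL_Md13_iff T).1 hT
  refine ⟨fun h => ⟨T 0 0, T 0 1, T 0 2, T 1 1, T 2 1, T 2 2, ?_⟩, fun hw => ?_⟩
  · convert HLequiv_refl (prodOf Md13) T using 1
    conv_rhs => rw [Matrix.eta_fin_three T, h, h₁, h₂]
  · let g := shear (T 2 1 / T 2 0) (T 2 2 / T 2 0)
    refine ⟨(g * T * g⁻¹) 0 0, (g * T * g⁻¹) 0 1, (g * T * g⁻¹) 0 2, T 1 1, T 2 0, hw,
      g, isAut_shear _ _, ?_⟩
    simp only [g, shear_inv]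
    ext i j
    fin_cases i <;> fin_cases j <;>
      simp [shear, Matrix.mul_apply, Matrix.vecMul, dotProduct, Fin.sum_univ_three,
        mul_div_cancel₀, h₁, h₂, hw]
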